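/- Let f: F_p^n → F_p^n be a uniformly random linear map whose kernel has dimension h, conditioned on Z ⊆ ker(f) and Y ∩ ker(f) = {0}, where Z, Y are fixed subspaces with Y ∩ Z = {0}. Then for any fixed linear map s defined on Z ⊕ Y, the probability that f agrees with s on Z ⊕ Y (given f vanishes on Z) does not depend on h. -/

import Mathlib

open Module

theorem Submodule.exists_le_le_finrank_eq {K V : Type*} [DivisionRing K] [AddCommGroup V]
    [Module K V] [FiniteDimensional K V] {A B : Submodule K V} (hAB : A ≤ B) {d : ℕ}
    (hA : finrank K A ≤ d) (hB : d ≤ finrank K B) :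
    ∃ C : Submodule K V, A ≤ C ∧ C ≤ B ∧ finrank K C = d := by
  induction d, hA using Nat.le_induction with
  | base => exact ⟨A, le_rfl, hAB, rfl⟩
  | succ d _ ih =>
    obtain ⟨C, hAC, hCB, hC⟩ := ih (by omega)
    have hlt : C < B := lt_of_le_of_ne hCB (by rintro rfl; omega)
    obtain ⟨v, hvB, hvC⟩ := SetLike.exists_of_lt hlt
    refine ⟨C ⊔ K ∙ v, hAC.trans le_sup_left, ?_, ?_⟩
    · exact sup_le hCB (by simpa using hvB)
    · rw [Submodule.finrank_sup_span_singleton hvC, hC]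

section KernelSets

variable {F V : Type*} [Field F] [AddCommGroup V] [Module F V]

/-- The endomorphisms with `h`-dimensional kernel that vanish on `Z` and are injective on `Y`. -/
abbrev KernelMaps (Z Y : Submodule F V) (h : ℕ) : Type _ :=
  {f : V →ₗ[F] V // finrank F (LinearMap.ker f) = h ∧ Z ≤ LinearMap.ker f ∧
    Y ⊓ LinearMap.ker f = ⊥}

/-- The members of `KernelMaps Z Y h` that restrict to `g` on `Y`. -/
abbrev KernelMapsExtending (Z Y : Submodule F V) (h : ℕ) (g : Y →ₗ[F] V) : Type _ :=
  {f : KernelMaps Z Y h // f.1.domRestrict Y = g}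

/-- Postcomposition with a linear automorphism. -/
def KernelMaps.postcomp {Z Y : Submodule F V} {h : ℕ} (e : V ≃ₗ[F] V)
    (f : KernelMaps Z Y h) : KernelMaps Z Y h :=
  ⟨e.toLinearMap ∘ₗ f.1, by rw [LinearEquiv.ker_comp]; exact f.2⟩

theorem LinearMap.injective_domRestrict_iff_inf_ker {Y : Submodule F V} {f : V →ₗ[F] V} :
    Function.Injective (f.domRestrict Y) ↔ Y ⊓ LinearMap.ker f = ⊥ := by
  simp only [LinearMap.injective_domRestrict_iff, disjoint_iff]

theorem exists_linearEquiv_comp_eq [FiniteDimensional F V] {Y : Submodule F V}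
    {g g' : Y →ₗ[F] V} (hg : Function.Injective g) (hg' : Function.Injective g') :
    ∃ e : V ≃ₗ[F] V, e.toLinearMap ∘ₗ g = g' := by
  obtain ⟨e, he⟩ := Submodule.exists_linearEquiv_restrict_eq
    ((LinearEquiv.ofInjective g hg).symm.trans (LinearEquiv.ofInjective g' hg'))
  refine ⟨e, LinearMap.ext fun x => ?_⟩
  simpa using (he (LinearEquiv.ofInjective g hg x)).symm

theorem card_kernelMapsExtending_eq [FiniteDimensional F V] (Z Y : Submodule F V) (h : ℕ)
    {g g' : Y →ₗ[F] V} (hg : Function.Injective g) (hg' : Function.Injective g') :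
    Nat.card (KernelMapsExtending Z Y h g) = Nat.card (KernelMapsExtending Z Y h g') := by
  obtain ⟨e, rfl⟩ := exists_linearEquiv_comp_eq hg hg'
  refine Nat.card_congr ⟨fun f => ⟨f.1.postcomp e, ?_⟩, fun f => ⟨f.1.postcomp e.symm, ?_⟩, ?_, ?_⟩
  · obtain ⟨f, rfl⟩ := f
    rfl
  · obtain ⟨f, hf⟩ := f
    ext x
    have := LinearMap.congr_fun hf x
    simpa [KernelMaps.postcomp, LinearEquiv.symm_apply_eq] using this
  · intro f
    ext x
    simp [KernelMaps.postcomp]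
  · intro f
    ext x
    simp [KernelMaps.postcomp]

theorem card_kernelMaps [Finite V] (Z Y : Submodule F V) (h : ℕ)
    {g : Y →ₗ[F] V} (hg : Function.Injective g) :
    Nat.card (KernelMaps Z Y h) =
      Nat.card {g : Y →ₗ[F] V // Function.Injective g} *
        Nat.card (KernelMapsExtending Z Y h g) := by
  have : Finite (V →ₗ[F] V) := DFunLike.finite _
  have : Finite (Y →ₗ[F] V) := DFunLike.finite _
  let r : KernelMaps Z Y h → {g : Y →ₗ[F] V // Function.Injective g} := fun f =>
    ⟨f.1.domRestrict Y, LinearMap.injective_domRestrict_iff_inf_ker.2 f.2.2.2⟩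
  have : Fintype {g : Y →ₗ[F] V // Function.Injective g} := Fintype.ofFinite _
  rw [← Nat.card_congr (Equiv.sigmaFiberEquiv r), Nat.card_sigma, Nat.card_eq_fintype_card,
    ← smul_eq_mul, ← Finset.card_univ, ← Finset.sum_const]
  refine Finset.sum_congr rfl fun g' _ => ?_
  rw [← card_kernelMapsExtending_eq Z Y h g'.2 hg]
  exact Nat.card_congr (Equiv.subtypeEquivRight fun f => Subtype.ext_iff)

theorem nonempty_kernelMaps [FiniteDimensional F V] {Z Y : Submodule F V} (hZY : Disjoint Z Y)
    {h : ℕ} (hZ : finrank F Z ≤ h) (hY : h + finrank F Y ≤ finrank F V) :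
    Nonempty (KernelMaps Z Y h) := by
  obtain ⟨W, hZW, hW⟩ := hZY.exists_isCompl
  have hfin := Submodule.finrank_add_eq_of_isCompl hW
  obtain ⟨K, hZK, hKW, hK⟩ := Submodule.exists_le_le_finrank_eq hZW hZ (by omega)
  obtain ⟨C, hC⟩ := K.exists_isCompl
  have hker : LinearMap.ker (C.projection K hC.symm) = K := Submodule.ker_projection _
  exact ⟨C.projection K hC.symm, by rw [hker, hK], by rwa [hker],
    by rw [hker]; exact (hW.disjoint.mono_left hKW).symm.eq_bot⟩

/-- The conditional probability that a random member of `KernelMaps Z Y h` extends an injective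
map on `Y` is the reciprocal of the number of such injective maps. -/
theorem card_kernelMapsExtending_div_card [Finite V] {Z Y : Submodule F V} (hZY : Disjoint Z Y)
    {h : ℕ} (hZ : finrank F Z ≤ h) (hY : h + finrank F Y ≤ finrank F V)
    {g : Y →ₗ[F] V} (hg : Function.Injective g) :
    (Nat.card (KernelMapsExtending Z Y h g) : ℝ) / Nat.card (KernelMaps Z Y h) =
      (Nat.card {g : Y →ₗ[F] V // Function.Injective g} : ℝ)⁻¹ := by
  have : Finite (V →ₗ[F] V) := DFunLike.finite _
  have := nonempty_kernelMaps hZY hZ hY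
  have hpos : Nat.card (KernelMaps Z Y h) ≠ 0 := Nat.card_pos.ne'
  rw [card_kernelMaps Z Y h hg] at hpos ⊢
  have h0 : (Nat.card (KernelMapsExtending Z Y h g) : ℝ) ≠ 0 :=
    Nat.cast_ne_zero.2 (right_ne_zero_of_mul hpos)
  rw [Nat.cast_mul, div_mul_cancel_right₀ h0]

theorem card_agreeing_eq_card_kernelMapsExtending {Z Y : Submodule F V} (h : ℕ)
    {s : V →ₗ[F] V} (hsZ : ∀ x ∈ Z, s x = 0) :
    Nat.card {f : V →ₗ[F] V // finrank F (LinearMap.ker f) = h ∧ Z ≤ LinearMap.ker f ∧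
      Y ⊓ LinearMap.ker f = ⊥ ∧ ∀ x ∈ Z ⊔ Y, f x = s x} =
      Nat.card (KernelMapsExtending Z Y h (s.domRestrict Y)) := by
  refine Nat.card_congr ((Equiv.subtypeEquivRight fun f => ?_).trans
    (Equiv.subtypeSubtypeEquivSubtypeInter
      (fun f : V →ₗ[F] V => finrank F (LinearMap.ker f) = h ∧ Z ≤ LinearMap.ker f ∧
        Y ⊓ LinearMap.ker f = ⊥) (fun f => f.domRestrict Y = s.domRestrict Y)).symm)
  simp only [and_assoc]
  refine and_congr_right fun _ => and_congr_right fun hZ => and_congr_right fun _ => ?_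
  constructor
  · intro hf
    ext x
    exact hf x (Submodule.mem_sup_right x.2)
  · intro hf x hx
    obtain ⟨z, hz, y, hy, rfl⟩ := Submodule.mem_sup.1 hx
    have hfy : f y = s y := LinearMap.congr_fun hf ⟨y, hy⟩
    rw [map_add, map_add, hsZ z hz, LinearMap.mem_ker.1 (hZ hz), hfy]

end KernelSets

open Module LinearMap in
theorem stmt_17 (p n : ℕ) (hp : IsPrimePow p)
    (F : Type) [Field F] [Fintype F] (hF : Fintype.card F = p)
    (Z Y : Submodule F (Fin n → F)) (hZY : Z ⊓ Y = ⊥)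
    (s : (Fin n → F) →ₗ[F] (Fin n → F)) (hsZ : ∀ x ∈ Z, s x = 0)
    (h h' : ℕ)
    (hh : finrank F Z ≤ h ∧ h + finrank F Y ≤ n)
    (hh' : finrank F Z ≤ h' ∧ h' + finrank F Y ≤ n) :
    (Nat.card {f : (Fin n → F) →ₗ[F] (Fin n → F) //
          finrank F (ker f) = h ∧ Z ≤ ker f ∧ Y ⊓ ker f = ⊥ ∧
          ∀ x ∈ Z ⊔ Y, f x = s x} : ℝ) /
        (Nat.card {f : (Fin n → F) →ₗ[F] (Fin n → F) //
          finrank F (ker f) = h ∧ Z ≤ ker f ∧ Y ⊓ ker f = ⊥} : ℝ) =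
      (Nat.card {f : (Fin n → F) →ₗ[F] (Fin n → F) //
          finrank F (ker f) = h' ∧ Z ≤ ker f ∧ Y ⊓ ker f = ⊥ ∧
          ∀ x ∈ Z ⊔ Y, f x = s x} : ℝ) /
        (Nat.card {f : (Fin n → F) →ₗ[F] (Fin n → F) //
          finrank F (ker f) = h' ∧ Z ≤ ker f ∧ Y ⊓ ker f = ⊥} : ℝ) := by
  have hd : Disjoint Z Y := disjoint_iff.2 hZY
  rw [card_agreeing_eq_card_kernelMapsExtending h hsZ,
    card_agreeing_eq_card_kernelMapsExtending h' hsZ]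
  by_cases hs : Function.Injective (s.domRestrict Y)
  · exact (card_kernelMapsExtending_div_card hd hh.1 (by simpa using hh.2) hs).trans
      (card_kernelMapsExtending_div_card hd hh'.1 (by simpa using hh'.2) hs).symm
  · have hempty (k : ℕ) : IsEmpty (KernelMapsExtending Z Y k (s.domRestrict Y)) :=
      ⟨fun f => hs (f.2 ▸ LinearMap.injective_domRestrict_iff_inf_ker.2 f.1.2.2.2)⟩
    rw [Nat.card_eq_zero.2 (.inl (hempty h)), Nat.card_eq_zero.2 (.inl (hempty h')),
      Nat.cast_zero, zero_div, zero_div]
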